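/- There are absolute constants c ≥ 10 and κ > 0 such that the following holds. Let m be a sufficiently large integer and let n = (1 − ε)·m be an integer with m^{−1/3} ≤ ε ≤ 1/c. Then for every history-independent insertion/deletion model at size n on m slots (with liveness defined via the constant c), if r is drawn uniformly from {1, …, n+1}, the starting configuration is A ∼ 𝒞_n, and one performs an insertion at rank r followed by a deletion at rank n+1, the expected total cost of the two operations is at least κ·ε^{−1}·(log₂ n)^{3/2}. -/

import Mathlib

open scoped BigOperators Classical

/-- Read slot `i` (mod `m`) of a cyclic array of `m` boolean slots. -/
def cyc (m : ℕ) (A : Fin m → Bool) (i : ℕ) : Bool :=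
  if h : 0 < m then A ⟨i % m, Nat.mod_lt i h⟩ else false

/-- Number of occupied slots among the `j` cyclically consecutive slots
`p, p+1, …, p+j-1`. -/
def blockCount (m : ℕ) (A : Fin m → Bool) (p j : ℕ) : ℕ :=
  ((Finset.range j).filter (fun t => cyc m A (p + t) = true)).card

/-- Density of the `j`-block starting at slot `p`. -/
noncomputable def blockDensity (m : ℕ) (A : Fin m → Bool) (p j : ℕ) : ℝ :=
  (blockCount m A p j : ℝ) / j

/-- A block is live (w.r.t. constant `c` and sparsity `ε`) if its density is
at least `1 - c·ε`. -/
def IsLive (c ε : ℝ) (m : ℕ) (A : Fin m → Bool) (p j : ℕ) : Prop :=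
  1 - c * ε ≤ blockDensity m A p j

/-- Imbalance of a `j`-block (for even `j`): difference of the densities of its
two halves. -/
noncomputable def imbalance (m : ℕ) (A : Fin m → Bool) (p j : ℕ) : ℝ :=
  |blockDensity m A p (j / 2) - blockDensity m A (p + j / 2) (j / 2)|

/-- Adjusted imbalance: the imbalance if the block is live, `0` if it is dead. -/
noncomputable def adjImbalance (c ε : ℝ) (m : ℕ) (A : Fin m → Bool) (p j : ℕ) : ℝ :=
  if IsLive c ε m A p j then imbalance m A p j else 0

/-- `Δ_j(A)`: the average adjusted imbalance over all `m` `j`-blocks. -/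
noncomputable def DeltaAvg (c ε : ℝ) (m : ℕ) (A : Fin m → Bool) (j : ℕ) : ℝ :=
  (∑ p ∈ Finset.range m, adjImbalance c ε m A p j) / m

/-- `J = {2, 4, 8, …, 2^(⌊log₂ m⌋ - 2)}`. -/
def Jset (m : ℕ) : Finset ℕ := (Finset.Icc 1 (Nat.log 2 m - 2)).image (fun i => 2 ^ i)

/-- The potential `φ` of a `j`-block: `0` if dead, `(μ - (1 - c·ε))²` if live,
where `μ` is its density. -/
noncomputable def potential (c ε : ℝ) (m : ℕ) (A : Fin m → Bool) (p j : ℕ) : ℝ :=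
  if IsLive c ε m A p j then (blockDensity m A p j - (1 - c * ε)) ^ 2 else 0

/-- An array configuration on `m` slots with `k` elements: a boolean occupancy
vector with exactly `k` occupied slots. -/
abbrev Config (m k : ℕ) :=
  {A : Fin m → Bool // (Finset.univ.filter (fun i => A i = true)).card = k}

/-- Expectation of a real-valued function under a probability mass function on a
finite type. -/
noncomputable def pexp {α : Type*} [Fintype α] (p : PMF α) (f : α → ℝ) : ℝ :=
  ∑ a, (p a).toReal * f a

/-- Probability of an event under a probability mass function on a finite type. -/
noncomputable def pprob {α : Type*} [Fintype α] (p : PMF α) (E : α → Prop) : ℝ :=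
  pexp p (fun a => if E a then 1 else 0)

/-- `posOf A s` is the position (0-indexed slot) of the rank-`s` element of `A`,
i.e. the `s`-th smallest occupied slot (`s` is 1-indexed). -/
def posOf {m : ℕ} (A : Fin m → Bool) (s : ℕ) : ℕ :=
  (((List.range m).filter (fun i => cyc m A i))).getD (s - 1) 0

/-- A history-independent insertion/deletion model at size `n` on `m` slots:
distributions `C0` (on `n`-element configurations) and `C1` (on `(n+1)`-element
configurations), insertion couplings `ins r` for each rank `r ∈ {1, …, n+1}`,
and a deletion coupling `del` for rank `n+1`, all with marginals `C0` and `C1`. -/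
structure HIModel (m n : ℕ) where
  C0 : PMF (Config m n)
  C1 : PMF (Config m (n + 1))
  ins : ℕ → PMF (Config m n × Config m (n + 1))
  del : PMF (Config m n × Config m (n + 1))
  ins_fst : ∀ r, 1 ≤ r → r ≤ n + 1 → PMF.map Prod.fst (ins r) = C0
  ins_snd : ∀ r, 1 ≤ r → r ≤ n + 1 → PMF.map Prod.snd (ins r) = C1
  del_fst : PMF.map Prod.fst del = C0
  del_snd : PMF.map Prod.snd del = C1

/-- The coupling `p` conditioned on its first coordinate being `A` (junk value
`p` itself when the conditioning event is null; such states are reached with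
probability zero). -/
noncomputable def condFst {m n : ℕ} (p : PMF (Config m n × Config m (n + 1)))
    (A : Config m n) : PMF (Config m n × Config m (n + 1)) :=
  if h : ∃ q ∈ {q : Config m n × Config m (n + 1) | q.1 = A}, q ∈ p.support then
    p.filter {q | q.1 = A} h
  else p

/-- The coupling `p` conditioned on its second coordinate being `A'`. -/
noncomputable def condSnd {m n : ℕ} (p : PMF (Config m n × Config m (n + 1)))
    (A' : Config m (n + 1)) : PMF (Config m n × Config m (n + 1)) :=
  if h : ∃ q ∈ {q : Config m n × Config m (n + 1) | q.2 = A'}, q ∈ p.support then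
    p.filter {q | q.2 = A'} h
  else p

/-- Rank of an old element after an insertion at rank `r`. -/
def insShift (r s : ℕ) : ℕ := if s < r then s else s + 1

/-- The (cyclic) slots of the 1st, `(j/2)`-th and `j`-th positions of the
`j`-block starting at slot `p`: the slots of the boundary set `B(x)`. -/
def boundarySlots (m p j : ℕ) : Finset ℕ :=
  {p % m, (p + j / 2 - 1) % m, (p + j - 1) % m}

/-- An insertion at rank `r` realized by the pair `(A0, A1)` is critical to the
`j`-block of `A0` starting at slot `p`: the block is live in `A0` and some
element of its boundary set is rearranged. -/
def InsCritical (c : ℝ) (m n r j p : ℕ) (A0 : Config m n) (A1 : Config m (n + 1)) : Prop :=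
  IsLive c (1 - (n : ℝ) / m) m A0.1 p j ∧
  ∃ s ∈ Finset.Icc 1 n, posOf A0.1 s ∈ boundarySlots m p j ∧
    posOf A0.1 s ≠ posOf A1.1 (insShift r s)

/-- A deletion at rank `n+1` realized by the pair `(A0, A1)` (`A1` before, `A0`
after) is critical to the `j`-block of `A1` starting at slot `p`. -/
def DelCritical (c : ℝ) (m n j p : ℕ) (A0 : Config m n) (A1 : Config m (n + 1)) : Prop :=
  IsLive c (1 - ((n : ℝ) + 1) / m) m A1.1 p j ∧
  ∃ s ∈ Finset.Icc 1 n, posOf A1.1 s ∈ boundarySlots m p j ∧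
    posOf A1.1 s ≠ posOf A0.1 s

/-- Probability that, starting from configuration `A` and performing `k`
insertion/deletion pairs (insertion at rank `r`, deletion at rank `n+1`),
no operation is critical to the `j`-block starting at the position of the
current rank-`t` element (in the configuration just before that operation). -/
noncomputable def probNoCrit (c : ℝ) {m n : ℕ} (Mo : HIModel m n) (t r j : ℕ) :
    ℕ → Config m n → ℝ
  | 0, _ => 1
  | k + 1, A =>
      pexp (condFst (Mo.ins r) A) fun q =>
        if InsCritical c m n r j (posOf q.1.1 t) q.1 q.2 then 0
        else pexp (condSnd Mo.del q.2) fun q' =>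
          if DelCritical c m n j (posOf q'.2.1 t) q'.1 q'.2 then 0
          else probNoCrit c Mo t r j k q'.1

/-- `Δ_j` for the stationary distribution `C0` of a model. -/
noncomputable def DeltaExp (c : ℝ) {m n : ℕ} (Mo : HIModel m n) (j : ℕ) : ℝ :=
  pexp Mo.C0 (fun A => DeltaAvg c (1 - (n : ℝ) / m) m A.1 j)

/-- Cost of an insertion at rank `r` realized by the pair `(A0, A1)`: one plus
the number of rearranged elements. -/
noncomputable def insCost (m n r : ℕ) (A0 : Config m n) (A1 : Config m (n + 1)) : ℕ :=
  1 + ((Finset.Icc 1 n).filter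
        (fun s => posOf A0.1 s ≠ posOf A1.1 (insShift r s))).card

/-- Cost of a deletion at rank `n+1` realized by the pair `(A0, A1)` (`A1`
before, `A0` after): one plus the number of rearranged elements. -/
noncomputable def delCost (m n : ℕ) (A0 : Config m n) (A1 : Config m (n + 1)) : ℕ :=
  1 + ((Finset.Icc 1 n).filter (fun s => posOf A1.1 s ≠ posOf A0.1 s)).card

/-- Expected total cost of an insertion at rank `r` (starting from `A ∼ C0`)
followed by a deletion at rank `n+1`. -/
noncomputable def expPairCost {m n : ℕ} (Mo : HIModel m n) (r : ℕ) : ℝ :=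
  pexp Mo.C0 (fun A =>
    pexp (condFst (Mo.ins r) A) (fun q =>
      (insCost m n r q.1 q.2 : ℝ) +
        pexp (condSnd Mo.del q.2) (fun q' => (delCost m n q'.1 q'.2 : ℝ))))

/-- occupied slot predicate -/
def oc {m : ℕ} (A : Fin m → Bool) (i : ℕ) : Prop := i < m ∧ cyc m A i = true

/-- number of occupied slots before `x` -/
noncomputable def cn {m : ℕ} (A : Fin m → Bool) (x : ℕ) : ℕ := Nat.count (oc A) x

lemma oc_finite {m : ℕ} (A : Fin m → Bool) : (Set.ofPred (oc A)).Finite :=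
  (Set.finite_lt_nat m).subset (fun _ h => h.1)

lemma posOf_nth {m : ℕ} (A : Fin m → Bool) (s : ℕ) :
    posOf A s = Nat.nth (oc A) (s - 1) := by
  rw [Nat.nth_eq_getD_sort (oc_finite A), posOf]
  congr 1
  symm
  have h1 : (oc_finite A).toFinset = ((List.range m).filter (fun i => cyc m A i)).toFinset := by
    ext x; simp [oc]
  rw [h1]
  apply List.Perm.eq_of_pairwise (le := (· ≤ ·))
  · intro a b _ _ h1 h2; exact le_antisymm h1 h2
  · exact Finset.pairwise_sort _ _
  · exact (List.pairwise_lt_range.filter _).imp le_of_lt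
  · refine (Finset.sort_perm_toList _ _).trans ?_
    exact List.toFinset_toList (List.nodup_range.filter _)

lemma oc_card {m k : ℕ} (A : Config m k) : (oc_finite A.1).toFinset.card = k := by
  refine Eq.trans ?_ A.2
  symm
  apply Finset.card_bij (fun (i : Fin m) _ => (i : ℕ))
  · intro a ha
    simp only [Finset.mem_filter, Finset.mem_univ, true_and] at ha
    have : 0 < m := a.pos
    simp [oc, cyc, this, Nat.mod_eq_of_lt a.2, ha]
  · intro a _ b _ h; exact Fin.ext h
  · intro b hb
    simp only [Set.Finite.mem_toFinset, Set.mem_ofPred_eq] at hb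
    obtain ⟨h1, h2⟩ := hb
    have : 0 < m := by omega
    refine ⟨⟨b, h1⟩, ?_, rfl⟩
    simpa [cyc, this, Nat.mod_eq_of_lt h1] using h2

lemma cn_succ {m : ℕ} (A : Fin m → Bool) (q : ℕ) (h : oc A q) : cn A (q+1) = cn A q + 1 := by
  simp [cn, Nat.count_succ, h]

lemma cn_mono {m : ℕ} (A : Fin m → Bool) {x y : ℕ} (h : x ≤ y) : cn A x ≤ cn A y :=
  Nat.count_monotone _ h

lemma cn_add_le {m : ℕ} (A : Fin m → Bool) (x y : ℕ) : cn A (x + y) ≤ cn A x + y := by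
  unfold cn
  rw [Nat.count_add]
  have := Nat.count_le (p := fun k => oc A (x + k)) (n := y)
  omega

lemma posOf_cn {m : ℕ} (A : Fin m → Bool) (q : ℕ) (h : oc A q) : posOf A (cn A (q+1)) = q := by
  rw [posOf_nth, cn_succ A q h]
  exact Nat.nth_count h

lemma posOf_spec {m k : ℕ} (A : Config m k) (s : ℕ) (h1 : 1 ≤ s) (h2 : s ≤ k) :
    oc A.1 (posOf A.1 s) ∧ cn A.1 (posOf A.1 s + 1) = s := by
  have hm : oc A.1 (posOf A.1 s) := by
    rw [posOf_nth]
    apply Nat.nth_mem_of_lt_card (oc_finite A.1)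
    rw [oc_card]; omega
  refine ⟨hm, ?_⟩
  rw [cn_succ _ _ hm, posOf_nth]
  unfold cn
  rw [Nat.count_nth]
  · omega
  · intro hf
    have := oc_card A
    have h3 : hf.toFinset.card = k := this
    omega

lemma cn_le {m k : ℕ} (A : Config m k) (x : ℕ) : cn A.1 x ≤ k := by
  unfold cn
  rw [Nat.count_eq_card_filter_range]
  refine le_trans ?_ (oc_card A).le
  apply Finset.card_le_card
  intro y; simp

lemma cn_m {m k : ℕ} (A : Config m k) : cn A.1 m = k := by
  unfold cn
  rw [Nat.count_eq_card_filter_range]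
  refine Eq.trans ?_ (oc_card A)
  congr 1
  ext y; simp; intro h; exact h.1

/-- rank of the last element of the left half -/
noncomputable def c1 {m : ℕ} (A : Fin m → Bool) (h t : ℕ) : ℕ := cn A (posOf A t + h)
/-- rank of the last element of the block -/
noncomputable def c2 {m : ℕ} (A : Fin m → Bool) (h t : ℕ) : ℕ := cn A (posOf A t + 2 * h)

/-- good block -/
def gd {m : ℕ} (θ : ℝ) (h t : ℕ) (A : Fin m → Bool) : Prop :=
  oc A (posOf A t) ∧ cn A (posOf A t + 1) = t ∧ oc A (posOf A t + h - 1) ∧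
  oc A (posOf A t + 2 * h - 1) ∧ (1 - θ) * (2 * h) ≤ (c2 A h t : ℝ) - t + 1

/-- signed imbalance -/
noncomputable def Sg {m : ℕ} (h t : ℕ) (A : Fin m → Bool) : ℤ := 2 * c1 A h t - c2 A h t - t + 1

lemma gd_facts {m : ℕ} {θ : ℝ} (hθ : θ ≤ 1/16) {h t : ℕ} (hh : 8 ≤ h) {A : Fin m → Bool}
    (g : gd θ h t A) :
    1 ≤ t ∧ posOf A (c1 A h t) = posOf A t + h - 1 ∧ posOf A (c2 A h t) = posOf A t + 2 * h - 1 ∧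
    8 * t + 7 * h ≤ 8 * c1 A h t + 8 ∧ 8 * t + 15 * h ≤ 8 * c2 A h t + 8 ∧
    c1 A h t + 1 ≤ t + h ∧ c2 A h t + 1 ≤ t + 2 * h := by
  obtain ⟨g1, g2, g3, g4, g5⟩ := g
  have e := cn_succ A _ g1
  have a1 := posOf_cn A _ g3
  have a2 := posOf_cn A _ g4
  rw [show posOf A t + h - 1 + 1 = posOf A t + h by omega] at a1
  rw [show posOf A t + 2 * h - 1 + 1 = posOf A t + 2 * h by omega] at a2
  have b1 : c1 A h t ≤ cn A (posOf A t) + h := cn_add_le A _ _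
  have b2 : c2 A h t ≤ cn A (posOf A t) + 2 * h := cn_add_le A _ _
  have b3 : c2 A h t ≤ c1 A h t + h := by
    unfold c1 c2
    rw [show posOf A t + 2 * h = posOf A t + h + h by ring]
    exact cn_add_le A _ _
  have b4 : 8 * t + 15 * h ≤ 8 * c2 A h t + 8 := by
    have : (8 * t + 15 * h : ℝ) ≤ 8 * c2 A h t + 8 := by
      have : (0:ℝ) ≤ h := by positivity
      nlinarith
    exact_mod_cast this
  refine ⟨by omega, a1, a2, by omega, b4, by omega, by omega⟩

lemma gd_left {m n : ℕ} {θ : ℝ} (hθ : θ ≤ 1/16) {h t r : ℕ} (hh : 8 ≤ h)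
    (A0 : Config m n) (A1 : Config m (n+1)) (g : gd θ h t A0.1)
    (r1 : 4 * t + h ≤ 4 * r) (r2 : 2 * r < 2 * t + h)
    (n0 : posOf A0.1 t = posOf A1.1 (insShift r t))
    (n1 : posOf A0.1 (c1 A0.1 h t) = posOf A1.1 (insShift r (c1 A0.1 h t)))
    (n2 : posOf A0.1 (c2 A0.1 h t) = posOf A1.1 (insShift r (c2 A0.1 h t))) :
    gd θ h t A1.1 ∧ Sg h t A1.1 = Sg h t A0.1 + 1 := by
  obtain ⟨f0, f1, f2, f3, f4, f5, f6⟩ := gd_facts hθ hh g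
  have l1 : c1 A0.1 h t ≤ n := cn_le A0 _
  have l2 : c2 A0.1 h t ≤ n := cn_le A0 _
  rw [insShift, if_pos (by omega)] at n0
  rw [insShift, if_neg (by omega), f1, n0] at n1
  rw [insShift, if_neg (by omega), f2, n0] at n2
  obtain ⟨s0, s0'⟩ := posOf_spec A1 t (by omega) (by omega)
  obtain ⟨s1, s1'⟩ := posOf_spec A1 (c1 A0.1 h t + 1) (by omega) (by omega)
  obtain ⟨s2, s2'⟩ := posOf_spec A1 (c2 A0.1 h t + 1) (by omega) (by omega)
  rw [← n1] at s1 s1'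
  rw [← n2] at s2 s2'
  rw [show posOf A1.1 t + h - 1 + 1 = posOf A1.1 t + h by omega] at s1'
  rw [show posOf A1.1 t + 2 * h - 1 + 1 = posOf A1.1 t + 2 * h by omega] at s2'
  have e1 : c1 A1.1 h t = c1 A0.1 h t + 1 := s1'
  have e2 : c2 A1.1 h t = c2 A0.1 h t + 1 := s2'
  refine ⟨⟨s0, s0', s1, s2, ?_⟩, ?_⟩
  · rw [e2]; have := g.2.2.2.2; push_cast; linarith
  · unfold Sg; rw [e1, e2]; push_cast; ring

lemma gd_right {m n : ℕ} {θ : ℝ} (hθ : θ ≤ 1/16) {h t r : ℕ} (hh : 8 ≤ h)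
    (A0 : Config m n) (A1 : Config m (n+1)) (g : gd θ h t A1.1)
    (r1 : t + 2 * h ≤ r) (r2 : r ≤ n + 1)
    (n0 : posOf A0.1 t = posOf A1.1 (insShift r t))
    (n1 : posOf A0.1 (c1 A1.1 h t) = posOf A1.1 (insShift r (c1 A1.1 h t)))
    (n2 : posOf A0.1 (c2 A1.1 h t) = posOf A1.1 (insShift r (c2 A1.1 h t))) :
    gd θ h t A0.1 ∧ Sg h t A1.1 = Sg h t A0.1 := by
  obtain ⟨f0, f1, f2, f3, f4, f5, f6⟩ := gd_facts hθ hh g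
  rw [insShift, if_pos (by omega)] at n0
  rw [insShift, if_pos (by omega), f1, ← n0] at n1
  rw [insShift, if_pos (by omega), f2, ← n0] at n2
  obtain ⟨s0, s0'⟩ := posOf_spec A0 t (by omega) (by omega)
  obtain ⟨s1, s1'⟩ := posOf_spec A0 (c1 A1.1 h t) (by omega) (by omega)
  obtain ⟨s2, s2'⟩ := posOf_spec A0 (c2 A1.1 h t) (by omega) (by omega)
  rw [n1] at s1 s1'
  rw [n2] at s2 s2'
  rw [show posOf A0.1 t + h - 1 + 1 = posOf A0.1 t + h by omega] at s1'
  rw [show posOf A0.1 t + 2 * h - 1 + 1 = posOf A0.1 t + 2 * h by omega] at s2'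
  have e1 : c1 A0.1 h t = c1 A1.1 h t := s1'
  have e2 : c2 A0.1 h t = c2 A1.1 h t := s2'
  refine ⟨⟨s0, s0', s1, s2, ?_⟩, ?_⟩
  · rw [e2]; exact g.2.2.2.2
  · unfold Sg; rw [e1, e2]

/-- moved ranks -/
noncomputable def mv (m n r : ℕ) (A0 : Config m n) (A1 : Config m (n + 1)) : Finset ℕ :=
  (Finset.Icc 1 n).filter (fun s => posOf A0.1 s ≠ posOf A1.1 (insShift r s))

/-- test function -/
noncomputable def ff {m : ℕ} (θ : ℝ) (h t : ℕ) (K : ℤ) (A : Fin m → Bool) : ℤ :=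
  if gd θ h t A then min (2 * K) (max 0 (Sg h t A + K)) else 0

/-- quiet good block -/
def qt {m : ℕ} (θ : ℝ) (h t : ℕ) (K : ℤ) (A : Fin m → Bool) : Prop :=
  gd θ h t A ∧ |Sg h t A| < K

def crit (m n r : ℕ) (θ : ℝ) (h t : ℕ) (A : Fin m → Bool)
    (A0 : Config m n) (A1 : Config m (n+1)) : Prop :=
  gd θ h t A ∧ (t ∈ mv m n r A0 A1 ∨ c1 A h t ∈ mv m n r A0 A1 ∨ c2 A h t ∈ mv m n r A0 A1)

def win0 (h t r : ℕ) : Prop := 4 * t + h ≤ 4 * r ∧ 2 * r < 2 * t + h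
def win1 (h t r : ℕ) : Prop := 4 * t + 9 * h ≤ 4 * r ∧ 2 * r < 2 * t + 5 * h

lemma step_left {m n : ℕ} {θ : ℝ} (hθ : θ ≤ 1/16) {h t r : ℕ} (hh : 8 ≤ h) {K : ℤ} (hK : 0 < K)
    (A0 : Config m n) (A1 : Config m (n+1)) (w : win0 h t r) :
    ff θ h t K A0.1 + (if qt θ h t K A0.1 then 1 else 0) ≤
      ff θ h t K A1.1 + (2 * K + 1) * (if crit m n r θ h t A0.1 A0 A1 then 1 else 0) := by
  have hn : 0 ≤ ff θ h t K A1.1 := by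
    unfold ff; split_ifs <;> omega
  by_cases g : gd θ h t A0.1
  swap
  · rw [if_neg (fun h => g h.1), if_neg (fun h => g h.1), ff, if_neg g]; omega
  by_cases hc : crit m n r θ h t A0.1 A0 A1
  · rw [if_pos hc]
    have : ff θ h t K A0.1 ≤ 2 * K := by unfold ff; split_ifs <;> omega
    split_ifs <;> omega
  · rw [if_neg hc]
    obtain ⟨f0, f1, f2, f3, f4, f5, f6⟩ := gd_facts hθ hh g
    have l1 : c1 A0.1 h t ≤ n := cn_le A0 _
    have l2 : c2 A0.1 h t ≤ n := cn_le A0 _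
    have hc' : ¬ (t ∈ mv m n r A0 A1 ∨ c1 A0.1 h t ∈ mv m n r A0 A1 ∨ c2 A0.1 h t ∈ mv m n r A0 A1) :=
      fun h => hc ⟨g, h⟩
    simp only [mv, Finset.mem_filter, Finset.mem_Icc, not_or, not_and, not_not] at hc'
    obtain ⟨k0, k1, k2⟩ := hc'
    obtain ⟨g', e⟩ := gd_left hθ hh A0 A1 g w.1 w.2 (k0 (by omega)) (k1 (by omega)) (k2 (by omega))
    unfold ff
    rw [if_pos g, if_pos g', e]
    by_cases q : qt θ h t K A0.1
    · rw [if_pos q]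
      have := abs_lt.1 q.2
      omega
    · rw [if_neg q]; omega

lemma step_right {m n : ℕ} {θ : ℝ} (hθ : θ ≤ 1/16) {h t r : ℕ} (hh : 8 ≤ h) {K : ℤ} (hK : 0 < K)
    (A0 : Config m n) (A1 : Config m (n+1)) (w : win1 h t r) (hr : r ≤ n + 1) :
    ff θ h t K A1.1 ≤
      ff θ h t K A0.1 + (2 * K + 1) * (if crit m n r θ h t A1.1 A0 A1 then 1 else 0) := by
  have hn : 0 ≤ ff θ h t K A0.1 := by
    unfold ff; split_ifs <;> omega
  by_cases g : gd θ h t A1.1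
  swap
  · rw [if_neg (fun h => g h.1), ff, if_neg g]; omega
  by_cases hc : crit m n r θ h t A1.1 A0 A1
  · rw [if_pos hc]
    have : ff θ h t K A1.1 ≤ 2 * K := by unfold ff; split_ifs <;> omega
    omega
  · rw [if_neg hc]
    obtain ⟨f0, f1, f2, f3, f4, f5, f6⟩ := gd_facts hθ hh g
    have hc' : ¬ (t ∈ mv m n r A0 A1 ∨ c1 A1.1 h t ∈ mv m n r A0 A1 ∨ c2 A1.1 h t ∈ mv m n r A0 A1) :=
      fun h => hc ⟨g, h⟩
    simp only [mv, Finset.mem_filter, Finset.mem_Icc, not_or, not_and, not_not] at hc'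
    obtain ⟨k0, k1, k2⟩ := hc'
    have w1 := w.1
    obtain ⟨g', e⟩ := gd_right hθ hh A0 A1 g (r := r) (by omega) hr (k0 (by omega)) (k1 (by omega)) (k2 (by omega))
    unfold ff
    rw [if_pos g, if_pos g', e]; omega

lemma crit_card {m n r : ℕ} {θ : ℝ} (hθ : θ ≤ 1/16) (A : Fin m → Bool)
    (A0 : Config m n) (A1 : Config m (n+1)) (H : Finset ℕ)
    (h8 : ∀ h ∈ H, 8 ≤ h) (hs : ∀ h ∈ H, ∀ h' ∈ H, h < h' → 32 * h ≤ h')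
    (w : ℕ → ℕ → ℕ → Prop) (hw : w = win0 ∨ w = win1)
    (X : Finset (ℕ × ℕ))
    (hX : ∀ x ∈ X, x.1 ∈ H ∧ w x.1 x.2 r ∧ crit m n r θ x.1 x.2 A A0 A1) :
    X.card ≤ 3 * (mv m n r A0 A1).card := by
  have key : ∀ h ∈ H, ∀ h' ∈ H, ∀ d : ℤ, h ≤ 4 * d → d ≤ 3 * h → h' ≤ 4 * d → d ≤ 3 * h' → h = h' := by
    intro h hh h' hh' d d1 d2 d3 d4
    have a1 := h8 h hh
    have a2 := h8 h' hh'
    rcases lt_trichotomy h h' with l | l | l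
    · have := hs h hh h' hh' l; omega
    · exact l
    · have := hs h' hh' h hh l; omega
  have h0 : (X.filter (fun x => x.2 ∈ mv m n r A0 A1)).card ≤ (mv m n r A0 A1).card := by
    apply Finset.card_le_card_of_injOn (fun x => x.2)
    · intro x hx; exact (Finset.mem_filter.1 hx).2
    · rintro ⟨h, t⟩ hx ⟨h', t'⟩ hx' e
      simp only [Finset.coe_filter, Set.mem_ofPred_eq] at hx hx' e
      subst e
      obtain ⟨a1, a2, a3⟩ := hX _ hx.1
      obtain ⟨b1, b2, b3⟩ := hX _ hx'.1
      simp only at a1 a2 b1 b2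
      have : h = h' := by
        apply key h a1 h' b1 ((r : ℤ) - t) <;>
        rcases hw with rfl | rfl <;> simp only [win0, win1] at a2 b2 <;> omega
      rw [this]
  have h1 : (X.filter (fun x => c1 A x.1 x.2 ∈ mv m n r A0 A1)).card ≤ (mv m n r A0 A1).card := by
    apply Finset.card_le_card_of_injOn (fun x => c1 A x.1 x.2)
    · intro x hx; exact (Finset.mem_filter.1 hx).2
    · rintro ⟨h, t⟩ hx ⟨h', t'⟩ hx' e
      simp only [Finset.coe_filter, Set.mem_ofPred_eq] at hx hx' e
      obtain ⟨a1, a2, a3⟩ := hX _ hx.1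
      obtain ⟨b1, b2, b3⟩ := hX _ hx'.1
      simp only at a1 a2 b1 b2 a3 b3
      obtain ⟨f0, f1, f2, f3, f4, f5, f6⟩ := gd_facts hθ (h8 h a1) a3.1
      obtain ⟨k0, k1, k2, k3, k4, k5, k6⟩ := gd_facts hθ (h8 h' b1) b3.1
      have e3 := h8 h a1
      have e4 := h8 h' b1
      have : h = h' := by
        rcases hw with rfl | rfl
        · apply key h a1 h' b1 ((c1 A h t : ℤ) - r) <;>
          simp only [win0] at a2 b2 <;> omega
        · apply key h a1 h' b1 (r - (c1 A h t : ℤ)) <;>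
          simp only [win1] at a2 b2 <;> omega
      subst this
      rw [← e, f1] at k1
      have e2 : posOf A t = posOf A t' := by omega
      rw [← a3.1.2.1, ← b3.1.2.1, e2]
  have h2 : (X.filter (fun x => c2 A x.1 x.2 ∈ mv m n r A0 A1)).card ≤ (mv m n r A0 A1).card := by
    apply Finset.card_le_card_of_injOn (fun x => c2 A x.1 x.2)
    · intro x hx; exact (Finset.mem_filter.1 hx).2
    · rintro ⟨h, t⟩ hx ⟨h', t'⟩ hx' e
      simp only [Finset.coe_filter, Set.mem_ofPred_eq] at hx hx' e
      obtain ⟨a1, a2, a3⟩ := hX _ hx.1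
      obtain ⟨b1, b2, b3⟩ := hX _ hx'.1
      simp only at a1 a2 b1 b2 a3 b3
      obtain ⟨f0, f1, f2, f3, f4, f5, f6⟩ := gd_facts hθ (h8 h a1) a3.1
      obtain ⟨k0, k1, k2, k3, k4, k5, k6⟩ := gd_facts hθ (h8 h' b1) b3.1
      have e3 := h8 h a1
      have e4 := h8 h' b1
      have : h = h' := by
        rcases hw with rfl | rfl
        · apply key h a1 h' b1 ((c2 A h t : ℤ) - r) <;>
          simp only [win0] at a2 b2 <;> omega
        · apply key h a1 h' b1 (r - (c2 A h t : ℤ)) <;>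
          simp only [win1] at a2 b2 <;> omega
      subst this
      rw [← e, f2] at k2
      have e2 : posOf A t = posOf A t' := by omega
      rw [← a3.1.2.1, ← b3.1.2.1, e2]
  have hu : X ⊆ (X.filter (fun x => x.2 ∈ mv m n r A0 A1)) ∪
      ((X.filter (fun x => c1 A x.1 x.2 ∈ mv m n r A0 A1)) ∪
       (X.filter (fun x => c2 A x.1 x.2 ∈ mv m n r A0 A1))) := by
    intro x hx
    obtain ⟨_, _, _, h3⟩ := hX x hx
    simp only [Finset.mem_union, Finset.mem_filter, hx, true_and]
    exact h3
  have u1 := Finset.card_le_card hu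
  have u2 := Finset.card_union_le (X.filter (fun x => x.2 ∈ mv m n r A0 A1))
      ((X.filter (fun x => c1 A x.1 x.2 ∈ mv m n r A0 A1)) ∪
       (X.filter (fun x => c2 A x.1 x.2 ∈ mv m n r A0 A1)))
  have u3 := Finset.card_union_le (X.filter (fun x => c1 A x.1 x.2 ∈ mv m n r A0 A1))
       (X.filter (fun x => c2 A x.1 x.2 ∈ mv m n r A0 A1))
  omega

lemma pexp_mono {α : Type*} [Fintype α] (p : PMF α) {f g : α → ℝ} (h : ∀ a, f a ≤ g a) :
    pexp p f ≤ pexp p g := by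
  unfold pexp
  exact Finset.sum_le_sum fun a _ => mul_le_mul_of_nonneg_left (h a) ENNReal.toReal_nonneg

lemma pexp_add {α : Type*} [Fintype α] (p : PMF α) (f g : α → ℝ) :
    pexp p (fun a => f a + g a) = pexp p f + pexp p g := by
  simp [pexp, mul_add, Finset.sum_add_distrib]

lemma pexp_smul {α : Type*} [Fintype α] (p : PMF α) (k : ℝ) (f : α → ℝ) :
    pexp p (fun a => k * f a) = k * pexp p f := by
  simp only [pexp, Finset.mul_sum]
  exact Finset.sum_congr rfl fun a _ => by ring

lemma pexp_sum {α ι : Type*} [Fintype α] (p : PMF α) (s : Finset ι) (f : ι → α → ℝ) :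
    pexp p (fun a => ∑ i ∈ s, f i a) = ∑ i ∈ s, pexp p (f i) := by
  simp only [pexp, Finset.mul_sum]
  exact Finset.sum_comm

lemma pexp_const {α : Type*} [Fintype α] (p : PMF α) (k : ℝ) :
    pexp p (fun _ => k) = k := by
  have h : ∑ a, (p a).toReal = 1 := by
    rw [← ENNReal.toReal_sum (fun a _ => p.apply_ne_top a), ← tsum_fintype (L := .unconditional _), p.tsum_coe]
    rfl
  rw [pexp, ← Finset.sum_mul, h, one_mul]

lemma pexp_map {α β : Type*} [Fintype α] [Fintype β] (p : PMF α) (g : α → β) (f : β → ℝ) :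
    pexp (p.map g) f = pexp p (fun a => f (g a)) := by
  simp only [pexp]
  have : ∀ b, ((p.map g) b).toReal = ∑ a, if b = g a then (p a).toReal else 0 := by
    intro b
    rw [PMF.map_apply, tsum_fintype, ENNReal.toReal_sum]
    · apply Finset.sum_congr rfl; intro a _; split_ifs <;> simp
    · intro a _; split_ifs
      · exact p.apply_ne_top a
      · simp
  simp only [this, Finset.sum_mul]
  rw [Finset.sum_comm]
  apply Finset.sum_congr rfl
  intro a _
  simp [ite_mul]

lemma condFst_mul {m n : ℕ} (p : PMF (Config m n × Config m (n + 1))) (A : Config m n)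
    (q : Config m n × Config m (n + 1)) :
    ((p.map Prod.fst) A).toReal * (condFst p A q).toReal =
      if q.1 = A then (p q).toReal else 0 := by
  have hmap : (p.map Prod.fst) A = ∑' a, ({q | q.1 = A} : Set _).indicator p a := by
    rw [PMF.map_apply]
    congr 1; ext a
    simp [Set.indicator_apply, eq_comm]
  unfold condFst
  split_ifs with h hq hq
  · rw [← ENNReal.toReal_mul, PMF.filter_apply, hmap, mul_left_comm, ENNReal.mul_inv_cancel, mul_one]
    · rw [Set.indicator_of_mem]; exact hq
    · rw [← hmap]
      obtain ⟨q', h1, h2⟩ := h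
      rw [← PMF.mem_support_iff, PMF.support_map]
      exact ⟨q', h2, h1⟩
    · rw [← hmap]; exact PMF.apply_ne_top _ _
  · rw [PMF.filter_apply_eq_zero_of_notMem]
    · simp
    · exact hq
  · have : p q = 0 := by
      by_contra h0
      exact h ⟨q, hq, h0⟩
    simp [this]
  · have : (p.map Prod.fst) A = 0 := by
      by_contra h0
      rw [← ne_eq, ← PMF.mem_support_iff, PMF.support_map] at h0
      obtain ⟨q', h1, h2⟩ := h0
      exact h ⟨q', h2, h1⟩
    simp [this]

lemma pexp_cond {m n : ℕ} (p : PMF (Config m n × Config m (n + 1)))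
    (G : Config m n × Config m (n + 1) → ℝ) :
    pexp (p.map Prod.fst) (fun A => pexp (condFst p A) G) = pexp p G := by
  simp only [pexp, Finset.mul_sum, ← mul_assoc, condFst_mul]
  rw [Finset.sum_comm]
  apply Finset.sum_congr rfl
  intro q _
  simp [ite_mul]

lemma cost_ge {m n : ℕ} (Mo : HIModel m n) (r : ℕ) (h1 : 1 ≤ r) (h2 : r ≤ n + 1) :
    pexp (Mo.ins r) (fun q => ((mv m n r q.1 q.2).card : ℝ)) ≤ expPairCost Mo r := by
  rw [← pexp_cond, expPairCost, Mo.ins_fst r h1 h2]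
  apply pexp_mono; intro A
  apply pexp_mono; intro q
  have : 0 ≤ pexp (condSnd Mo.del q.2) (fun q' => (delCost m n q'.1 q'.2 : ℝ)) :=
    Finset.sum_nonneg fun a _ => mul_nonneg ENNReal.toReal_nonneg (by positivity)
  unfold insCost mv
  push_cast
  linarith

lemma model_step {m n : ℕ} (Mo : HIModel m n) {θ : ℝ} (hθ : θ ≤ 1/16) {h t : ℕ} (hh : 8 ≤ h)
    {K : ℕ} (hK : 0 < K) {r r' : ℕ} (hr : 1 ≤ r) (hr' : r' ≤ n + 1)
    (w : win0 h t r) (w' : win1 h t r') :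
    pprob Mo.C0 (fun A => qt θ h t K A.1) ≤ (2 * K + 1) *
      (pprob (Mo.ins r) (fun q => crit m n r θ h t q.1.1 q.1 q.2) +
       pprob (Mo.ins r') (fun q => crit m n r' θ h t q.2.1 q.1 q.2)) := by
  have w1 := w.1; have w2 := w.2; have w3 := w'.1; have w4 := w'.2
  have hr1 : r ≤ n + 1 := by omega
  have hr2 : 1 ≤ r' := by omega
  have hK' : (0:ℤ) < K := by exact_mod_cast hK
  have e1 : pexp Mo.C0 (fun A => (ff θ h t K A.1 : ℝ)) + pprob Mo.C0 (fun A => qt θ h t K A.1) ≤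
     pexp Mo.C1 (fun A => (ff θ h t K A.1 : ℝ)) + (2 * K + 1) * pprob (Mo.ins r) (fun q => crit m n r θ h t q.1.1 q.1 q.2) := by
    unfold pprob
    rw [← pexp_add, ← pexp_smul]
    nth_rw 1 [← Mo.ins_fst r hr hr1]
    rw [← Mo.ins_snd r hr hr1, pexp_map, pexp_map, ← pexp_add]
    apply pexp_mono; intro q
    have := step_left hθ hh hK' q.1 q.2 w
    have h2 : ((ff θ h t K q.1.1 + (if qt θ h t K q.1.1 then 1 else 0) : ℤ) : ℝ) ≤
      ((ff θ h t K q.2.1 + (2 * K + 1) * (if crit m n r θ h t q.1.1 q.1 q.2 then 1 else 0) : ℤ) : ℝ) := by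
      exact_mod_cast this
    push_cast at h2
    exact h2
  have e2 : pexp Mo.C1 (fun A => (ff θ h t K A.1 : ℝ)) ≤
     pexp Mo.C0 (fun A => (ff θ h t K A.1 : ℝ)) + (2 * K + 1) * pprob (Mo.ins r') (fun q => crit m n r' θ h t q.2.1 q.1 q.2) := by
    unfold pprob
    rw [← pexp_smul]
    nth_rw 1 [← Mo.ins_fst r' hr2 hr']
    rw [← Mo.ins_snd r' hr2 hr', pexp_map, pexp_map, ← pexp_add]
    apply pexp_mono; intro q
    have := step_right hθ hh hK' q.1 q.2 w' hr'
    have h2 : ((ff θ h t K q.2.1 : ℤ) : ℝ) ≤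
      ((ff θ h t K q.1.1 + (2 * K + 1) * (if crit m n r' θ h t q.2.1 q.1 q.2 then 1 else 0) : ℤ) : ℝ) := by
      exact_mod_cast this
    push_cast at h2
    exact h2
  linarith

lemma sum_shift {m : ℕ} (g : ℕ → ℝ) (hg : ∀ p, g (p + m) = g p) (s : ℕ) :
    ∑ p ∈ Finset.range m, g (p + s) = ∑ p ∈ Finset.range m, g p := by
  induction s with
  | zero => rfl
  | succ s ih =>
    rw [← ih]
    have h1 := Finset.sum_range_succ (fun p => g (p + s)) m
    have h2 := Finset.sum_range_succ' (fun p => g (p + s)) m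
    have h3 : g (m + s) = g (0 + s) := by rw [add_comm m s, hg, zero_add]
    have h4 : ∑ p ∈ Finset.range m, g (p + (s + 1)) = ∑ k ∈ Finset.range m, g (k + 1 + s) :=
      Finset.sum_congr rfl fun k _ => by congr 1; ring
    rw [h4]
    linarith

lemma cyc_per {m : ℕ} (A : Fin m → Bool) (p : ℕ) : cyc m A (p + m) = cyc m A p := by
  simp [cyc]

lemma bc_per {m : ℕ} (A : Fin m → Bool) (p j : ℕ) : blockCount m A (p + m) j = blockCount m A p j := by
  unfold blockCount
  congr 1
  apply Finset.filter_congr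
  intro t _
  rw [add_right_comm, cyc_per]

lemma bc_count {m : ℕ} (A : Fin m → Bool) (p j : ℕ) :
    blockCount m A p j = Nat.count (fun t => cyc m A (p + t) = true) j := by
  rw [Nat.count_eq_card_filter_range]; unfold blockCount; rfl

lemma bc_add {m : ℕ} (A : Fin m → Bool) (p a b : ℕ) :
    blockCount m A p (a + b) = blockCount m A p a + blockCount m A (p + a) b := by
  rw [bc_count, bc_count, bc_count, Nat.count_add]
  simp only [add_assoc]

lemma bc_cn {m : ℕ} (A : Fin m → Bool) (p j : ℕ) (h : p + j ≤ m) :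
    cn A (p + j) = cn A p + blockCount m A p j := by
  rw [bc_count, cn, Nat.count_add, cn]
  congr 1
  rw [Nat.count_eq_card_filter_range, Nat.count_eq_card_filter_range]
  congr 1
  apply Finset.filter_congr
  intro t ht
  simp only [Finset.mem_range] at ht
  simp only [oc]
  constructor
  · exact fun h => h.2
  · exact fun h => ⟨by omega, h⟩

/-- potential -/
noncomputable def ph (x : ℝ) : ℝ := (max x 0) ^ 2

lemma ph_conv (a b u : ℝ) (hu : 2 * u = a + b) :
    2 * ph u + (if 0 ≤ u then (a - b) ^ 2 / 4 else 0) ≤ ph a + ph b := by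
  unfold ph
  split_ifs with h
  · rw [max_eq_left h]
    rcases le_total 0 a with ha | ha <;> rcases le_total 0 b with hb | hb
    · rw [max_eq_left ha, max_eq_left hb]
      have : u = (a + b) / 2 := by linarith
      subst this; nlinarith [sq_nonneg (a - b)]
    · rw [max_eq_left ha, max_eq_right hb]
      have : u = (a + b) / 2 := by linarith
      subst this; nlinarith [mul_nonneg ha (neg_nonneg.2 hb)]
    · rw [max_eq_right ha, max_eq_left hb]
      have : u = (a + b) / 2 := by linarith
      subst this; nlinarith [mul_nonneg hb (neg_nonneg.2 ha)]
    · have h1 : a = 0 := by linarith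
      have h2 : b = 0 := by linarith
      subst h1 h2
      have : u = 0 := by linarith
      subst this; simp
  · rw [max_eq_right (by linarith)]
    nlinarith [sq_nonneg (max a 0), sq_nonneg (max b 0)]

/-- live -/
def lv {m : ℕ} (θ : ℝ) (A : Fin m → Bool) (h p : ℕ) : Prop :=
  (1 - θ) * (2 * h) ≤ (blockCount m A p (2 * h) : ℝ)

noncomputable def Dv {m : ℕ} (θ : ℝ) (A : Fin m → Bool) (h : ℕ) : ℝ :=
  ∑ p ∈ Finset.range m, if lv θ A h p then
    (((blockCount m A p h : ℝ) - blockCount m A (p + h) h) / h) ^ 2 else 0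

noncomputable def Ph {m : ℕ} (θ : ℝ) (A : Fin m → Bool) (j : ℕ) : ℝ :=
  ∑ p ∈ Finset.range m, ph ((blockCount m A p j : ℝ) / j - (1 - θ))

lemma Ph_step {m : ℕ} (θ : ℝ) (A : Fin m → Bool) (h : ℕ) (hh : 0 < h) :
    Dv θ A h ≤ 8 * (Ph θ A h - Ph θ A (2 * h)) := by
  have hs : Ph θ A h = ∑ p ∈ Finset.range m, ph ((blockCount m A (p + h) h : ℝ) / h - (1 - θ)) := by
    unfold Ph
    rw [sum_shift (fun p => ph ((blockCount m A p h : ℝ) / h - (1 - θ)))]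
    intro p; simp only [bc_per]
  have h0 : (0:ℝ) < h := by exact_mod_cast hh
  have : 2 * Ph θ A (2 * h) + Dv θ A h / 4 ≤ Ph θ A h + Ph θ A h := by
    nth_rw 2 [hs]
    unfold Ph Dv
    rw [Finset.mul_sum, Finset.sum_div, ← Finset.sum_add_distrib, ← Finset.sum_add_distrib]
    apply Finset.sum_le_sum
    intro p _
    have e : (blockCount m A p (2 * h) : ℝ) = blockCount m A p h + blockCount m A (p + h) h := by
      rw [two_mul, bc_add]; push_cast; rfl
    have := ph_conv ((blockCount m A p h : ℝ) / h - (1 - θ)) ((blockCount m A (p + h) h : ℝ) / h - (1 - θ))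
      ((blockCount m A p (2 * h) : ℝ) / ((2 * h : ℕ) : ℝ) - (1 - θ)) (by
        rw [e]; push_cast; field_simp; ring)
    refine le_trans (le_of_eq ?_) this
    congr 1
    have e2 : lv θ A h p ↔ 0 ≤ (blockCount m A p (2 * h) : ℝ) / ((2 * h : ℕ) : ℝ) - (1 - θ) := by
      unfold lv
      rw [sub_nonneg, le_div_iff₀ (by positivity)]
      push_cast; rfl
    simp only [e2]
    split_ifs
    · congr 1; congr 1
      rw [sub_div]; ring
    · simp
  linarith

lemma Dv_nonneg {m : ℕ} (θ : ℝ) (A : Fin m → Bool) (h : ℕ) : 0 ≤ Dv θ A h := by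
  unfold Dv
  apply Finset.sum_nonneg; intro p _; split_ifs <;> positivity

lemma Dv_sum {m : ℕ} {θ : ℝ} (hθ : 0 ≤ θ) (A : Fin m → Bool) (N : ℕ) (H : Finset ℕ)
    (hH : ∀ h ∈ H, ∃ i < N, h = 2 ^ i) :
    ∑ h ∈ H, Dv θ A h ≤ 8 * (m * θ ^ 2) := by
  have h1 : ∑ h ∈ H, Dv θ A h ≤ ∑ h ∈ (Finset.range N).image (fun i => 2 ^ i), Dv θ A h := by
    apply Finset.sum_le_sum_of_subset_of_nonneg
    · intro h hh
      obtain ⟨i, hi, e⟩ := hH h hh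
      exact Finset.mem_image.2 ⟨i, Finset.mem_range.2 hi, e.symm⟩
    · intros; exact Dv_nonneg _ _ _
  rw [Finset.sum_image (fun a _ b _ e => Nat.pow_right_injective le_rfl e)] at h1
  have h2 : ∑ i ∈ Finset.range N, Dv θ A (2 ^ i) ≤ 8 * (Ph θ A (2 ^ 0) - Ph θ A (2 ^ N)) := by
    rw [← Finset.sum_range_sub' (fun i => Ph θ A (2 ^ i)), Finset.mul_sum]
    apply Finset.sum_le_sum
    intro i _
    have := Ph_step θ A (2 ^ i) (by positivity)
    rwa [← pow_succ'] at this
  have h3 : 0 ≤ Ph θ A (2 ^ N) := Finset.sum_nonneg fun p _ => sq_nonneg _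
  have h4 : Ph θ A (2 ^ 0) ≤ m * θ ^ 2 := by
    unfold Ph
    refine (Finset.sum_le_card_nsmul _ _ (θ ^ 2) ?_).trans (by simp)
    intro p _
    unfold ph
    have : (blockCount m A p (2 ^ 0) : ℝ) ≤ 1 := by
      have := Nat.count_le (p := fun t => cyc m A (p + t) = true) (n := 1)
      rw [← bc_count] at this
      exact_mod_cast this
    have h5 : max ((blockCount m A p (2 ^ 0) : ℝ) / ((2 ^ 0 : ℕ) : ℝ) - (1 - θ)) 0 ≤ θ := by
      apply max_le _ hθ
      simp at this ⊢; linarith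
    exact pow_le_pow_left₀ (le_max_right _ _) h5 2
  linarith

/-- empty-slot indicator -/
noncomputable def emp {m : ℕ} (A : Fin m → Bool) (p : ℕ) : ℝ := if cyc m A p = true then 0 else 1

lemma emp_sum {m n : ℕ} (A : Config m n) (s : ℕ) :
    ∑ p ∈ Finset.range m, emp A.1 (p + s) = m - n := by
  rw [sum_shift (emp A.1) (fun p => by simp only [emp, cyc_per])]
  have h1 : blockCount m A.1 0 m = n := by
    have := bc_cn A.1 0 m (by omega)
    rw [zero_add, cn_m] at this
    simp only [cn, Nat.count_zero, zero_add] at this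
    exact this.symm
  have : ∀ p, emp A.1 p = 1 - (if cyc m A.1 p = true then (1:ℝ) else 0) := by
    intro p; unfold emp; split_ifs <;> norm_num
  simp only [this, Finset.sum_sub_distrib]
  rw [← Finset.sum_filter]
  nth_rw 3 [← h1]
  simp [blockCount]

lemma bc_sum {m n : ℕ} (A : Config m n) (j : ℕ) :
    ∑ p ∈ Finset.range m, ((j : ℝ) - blockCount m A.1 p j) = j * (m - n) := by
  have : ∀ p, (j : ℝ) - blockCount m A.1 p j = ∑ t ∈ Finset.range j, emp A.1 (p + t) := by
    intro p
    have h : ∀ p, emp A.1 p = 1 - (if cyc m A.1 p = true then (1:ℝ) else 0) := by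
      intro p; unfold emp; split_ifs <;> norm_num
    simp only [h, Finset.sum_sub_distrib, ← Finset.sum_filter]
    simp [blockCount]
  simp only [this]
  rw [Finset.sum_comm]
  simp [emp_sum]
  ring

def qs {m n : ℕ} (θ : ℝ) (A : Config m n) (h K p : ℕ) : Prop :=
  oc A.1 p ∧ cyc m A.1 (p + (h - 1)) = true ∧ cyc m A.1 (p + (2 * h - 1)) = true ∧ lv θ A.1 h p ∧
  |(blockCount m A.1 p h : ℤ) - blockCount m A.1 (p + h) h| < K ∧ cn A.1 p + 1 + 4 * h ≤ n

lemma qs_le {m n : ℕ} (θ : ℝ) (A : Config m n) (h K : ℕ) (hh : 8 ≤ h) :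
    ((Finset.range m).filter (qs θ A h K)).card ≤
      ((Finset.Icc 1 (n - 4 * h)).filter (fun t => qt θ h t K A.1)).card := by
  apply Finset.card_le_card_of_injOn (fun p => cn A.1 (p + 1))
  · intro p hp
    obtain ⟨hp, q1, q2, q3, q4, q5, q6⟩ := Finset.mem_filter.1 hp
    have e0 := cn_succ _ _ q1
    have e1 := posOf_cn _ _ q1
    have hpm : p + 4 * h ≤ m := by
      have h1 := cn_add_le A.1 p (m - p)
      have h2 := q1.1
      rw [show p + (m - p) = m by omega, cn_m] at h1
      omega
    have b2 := bc_cn A.1 p (2 * h) (by omega)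
    have b1 := bc_cn A.1 p h (by omega)
    have b3 := bc_add A.1 p h h
    rw [← two_mul] at b3
    refine Finset.mem_filter.2 ⟨Finset.mem_Icc.2 ⟨by simp only [e0]; omega, by simp only [e0]; omega⟩, ⟨?_, ?_, ?_, ?_, ?_⟩, ?_⟩
    · rw [e1]; exact q1
    · rw [e1]
    · rw [e1]; refine ⟨by omega, ?_⟩
      rw [show p + h - 1 = p + (h - 1) by omega]; exact q2
    · rw [e1]; refine ⟨by omega, ?_⟩
      rw [show p + 2 * h - 1 = p + (2 * h - 1) by omega]; exact q3
    · simp only [c2, e1]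
      rw [b2, e0]
      have := q4
      unfold lv at this
      push_cast; linarith
    · simp only [Sg, c1, c2, e1]
      rw [b1, b2, b3, e0]
      push_cast
      convert q5 using 2
      ring
  · intro p hp p' hp' e
    obtain ⟨hp, q⟩ := Finset.mem_filter.1 hp
    obtain ⟨hp', q'⟩ := Finset.mem_filter.1 hp'
    simp only at e
    rw [← posOf_cn _ _ q.1, ← posOf_cn _ _ q'.1, e]

lemma tail_le {m n : ℕ} (A : Config m n) (h : ℕ) :
    ((Finset.range m).filter (fun p => oc A.1 p ∧ n < cn A.1 p + 1 + 4 * h)).card ≤ 4 * h := by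
  have : (Finset.Ioc (n - 4 * h) n).card ≤ 4 * h := by simp; omega
  refine le_trans ?_ this
  apply Finset.card_le_card_of_injOn (fun p => cn A.1 (p + 1))
  · intro p hp
    obtain ⟨hp, q1, q2⟩ := Finset.mem_filter.1 hp
    have e0 := cn_succ _ _ q1
    have := cn_le A (p + 1)
    simp only [Finset.coe_Ioc, Set.mem_Ioc]
    omega
  · intro p hp p' hp' e
    obtain ⟨hp, q⟩ := Finset.mem_filter.1 hp
    obtain ⟨hp', q'⟩ := Finset.mem_filter.1 hp'
    simp only at e
    rw [← posOf_cn _ _ q.1, ← posOf_cn _ _ q'.1, e]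

lemma qs_ge {m n : ℕ} {θ x : ℝ} (hθ : 0 < θ) (hx : 0 < x) (A : Config m n) (h K : ℕ) (hh : 8 ≤ h)
    (hK : x * h ≤ K) :
    (m : ℝ) ≤ ((Finset.range m).filter (qs θ A h K)).card + 3 * ((m:ℝ) - n) + ((m:ℝ) - n) / θ +
      Dv θ A.1 h / x ^ 2 + 4 * h := by
  have h0 : (0:ℝ) < h := by exact_mod_cast (by omega : 0 < h)
  have pt : ∀ p ∈ Finset.range m, (1:ℝ) ≤ (if qs θ A h K p then 1 else 0) +
     (emp A.1 (p + 0) + emp A.1 (p + (h - 1)) + emp A.1 (p + (2 * h - 1))) +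
     (((2 * h : ℕ) : ℝ) - blockCount m A.1 p (2 * h)) / (2 * h * θ) +
     (if lv θ A.1 h p then
        (((blockCount m A.1 p h : ℝ) - blockCount m A.1 (p + h) h) / h) ^ 2 else 0) / x ^ 2 +
     (if oc A.1 p ∧ n < cn A.1 p + 1 + 4 * h then 1 else 0) := by
    intro p hp
    have e0 : ∀ p, 0 ≤ emp A.1 p := fun p => by unfold emp; split_ifs <;> norm_num
    have a1 := e0 (p + 0)
    have a2 := e0 (p + (h - 1))
    have a3 := e0 (p + (2 * h - 1))
    have a4 : (0:ℝ) ≤ if qs θ A h K p then 1 else 0 := by split_ifs <;> norm_num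
    have a5 : 0 ≤ (((2 * h : ℕ) : ℝ) - blockCount m A.1 p (2 * h)) / (2 * h * θ) := by
      apply div_nonneg _ (by positivity)
      rw [sub_nonneg, bc_count]
      exact_mod_cast Nat.count_le _
    have a6 : 0 ≤ (if lv θ A.1 h p then
        (((blockCount m A.1 p h : ℝ) - blockCount m A.1 (p + h) h) / h) ^ 2 else 0) / x ^ 2 := by
      split_ifs <;> positivity
    have a7 : (0:ℝ) ≤ (if oc A.1 p ∧ n < cn A.1 p + 1 + 4 * h then 1 else 0) := by
      split_ifs <;> norm_num
    by_cases b1 : cyc m A.1 p = true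
    swap
    · have : emp A.1 (p + 0) = 1 := by rw [emp, if_neg]; exact b1
      linarith
    by_cases b2 : cyc m A.1 (p + (h - 1)) = true
    swap
    · have : emp A.1 (p + (h - 1)) = 1 := by rw [emp, if_neg]; exact b2
      linarith
    by_cases b3 : cyc m A.1 (p + (2 * h - 1)) = true
    swap
    · have : emp A.1 (p + (2 * h - 1)) = 1 := by rw [emp, if_neg]; exact b3
      linarith
    by_cases b4 : lv θ A.1 h p
    swap
    · have : 1 ≤ (((2 * h : ℕ) : ℝ) - blockCount m A.1 p (2 * h)) / (2 * h * θ) := by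
        rw [le_div_iff₀ (by positivity)]
        unfold lv at b4
        push_cast
        nlinarith
      linarith
    by_cases b5 : |(blockCount m A.1 p h : ℤ) - blockCount m A.1 (p + h) h| < K
    swap
    · have : 1 ≤ (if lv θ A.1 h p then
        (((blockCount m A.1 p h : ℝ) - blockCount m A.1 (p + h) h) / h) ^ 2 else 0) / x ^ 2 := by
        rw [if_pos b4, le_div_iff₀ (by positivity), one_mul, div_pow, le_div_iff₀ (by positivity),
          ← mul_pow, ← sq_abs ((blockCount m A.1 p h : ℝ) - _)]
        apply pow_le_pow_left₀ (by positivity)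
        refine hK.trans ?_
        have : (K : ℤ) ≤ |(blockCount m A.1 p h : ℤ) - blockCount m A.1 (p + h) h| := not_lt.1 b5
        exact_mod_cast this
      linarith
    have b0 : oc A.1 p := ⟨Finset.mem_range.1 hp, b1⟩
    by_cases b6 : cn A.1 p + 1 + 4 * h ≤ n
    · rw [if_pos (show qs θ A h K p from ⟨b0, b2, b3, b4, b5, b6⟩)]; linarith
    · rw [if_pos (show oc A.1 p ∧ n < cn A.1 p + 1 + 4 * h from ⟨b0, by omega⟩)]; linarith
  have := Finset.sum_le_sum pt
  simp only [Finset.sum_add_distrib, ← Finset.sum_div, emp_sum, bc_sum] at this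
  have t := tail_le A h
  have t' : (((Finset.range m).filter (fun p => oc A.1 p ∧ n < cn A.1 p + 1 + 4 * h)).card : ℝ) ≤ 4 * h := by
    exact_mod_cast t
  simp only [Finset.sum_boole] at this
  simp only [Finset.sum_const, Finset.card_range, nsmul_eq_mul, mul_one] at this
  have e : ((2 * h : ℕ) : ℝ) * ((m:ℝ) - n) / (2 * h * θ) = ((m:ℝ) - n) / θ := by
    push_cast; field_simp
  rw [e] at this
  unfold Dv
  linarith

noncomputable def Zc {m n : ℕ} (Mo : HIModel m n) (θ : ℝ) (w : ℕ → ℕ → ℕ → Prop)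
    (sel : Config m n × Config m (n+1) → (Fin m → Bool)) (h t r : ℕ) : ℝ :=
  pprob (Mo.ins r) (fun q => w h t r ∧ crit m n r θ h t (sel q) q.1 q.2)

lemma Zc_nonneg {m n : ℕ} (Mo : HIModel m n) (θ : ℝ) (w : ℕ → ℕ → ℕ → Prop)
    (sel : Config m n × Config m (n+1) → (Fin m → Bool)) (h t r : ℕ) : 0 ≤ Zc Mo θ w sel h t r := by
  unfold Zc pprob pexp
  apply Finset.sum_nonneg; intro a _
  apply mul_nonneg ENNReal.toReal_nonneg
  beta_reduce
  split_ifs <;> norm_num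

lemma charge {m n : ℕ} (Mo : HIModel m n) {θ : ℝ} (hθ : θ ≤ 1/16) (H : Finset ℕ)
    (h8 : ∀ h ∈ H, 8 ≤ h) (hs : ∀ h ∈ H, ∀ h' ∈ H, h < h' → 32 * h ≤ h')
    (w : ℕ → ℕ → ℕ → Prop) (hw : w = win0 ∨ w = win1)
    (sel : Config m n × Config m (n+1) → (Fin m → Bool)) :
    ∑ h ∈ H, ∑ t ∈ Finset.Icc 1 (n - 4 * h), ∑ r ∈ Finset.Icc 1 (n + 1), Zc Mo θ w sel h t r ≤
      3 * ∑ r ∈ Finset.Icc 1 (n + 1), expPairCost Mo r := by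
  have h1 : ∑ h ∈ H, ∑ t ∈ Finset.Icc 1 (n - 4 * h), ∑ r ∈ Finset.Icc 1 (n + 1), Zc Mo θ w sel h t r
      ≤ ∑ h ∈ H, ∑ t ∈ Finset.Icc 1 n, ∑ r ∈ Finset.Icc 1 (n + 1), Zc Mo θ w sel h t r := by
    apply Finset.sum_le_sum; intro h _
    apply Finset.sum_le_sum_of_subset_of_nonneg
    · apply Finset.Icc_subset_Icc le_rfl; omega
    · intros; exact Finset.sum_nonneg fun _ _ => Zc_nonneg _ _ _ _ _ _ _
  refine h1.trans ?_
  rw [← Finset.sum_product' (f := fun h t => ∑ r ∈ Finset.Icc 1 (n + 1), Zc Mo θ w sel h t r),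
    Finset.sum_comm, Finset.mul_sum]
  apply Finset.sum_le_sum
  intro r hr
  obtain ⟨r1, r2⟩ := Finset.mem_Icc.1 hr
  refine le_trans ?_ (mul_le_mul_of_nonneg_left (cost_ge Mo r r1 r2) (by norm_num))
  rw [← pexp_smul]
  unfold Zc pprob
  rw [← pexp_sum]
  apply pexp_mono
  intro q
  beta_reduce
  have := crit_card (r := r) hθ (sel q) q.1 q.2 H h8 hs w hw
    ((H ×ˢ Finset.Icc 1 n).filter (fun x => w x.1 x.2 r ∧ crit m n r θ x.1 x.2 (sel q) q.1 q.2))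
    (by
      intro x hx
      obtain ⟨hx, h1, h2⟩ := Finset.mem_filter.1 hx
      exact ⟨(Finset.mem_product.1 hx).1, h1, h2⟩)
  have this2 : (((H ×ˢ Finset.Icc 1 n).filter (fun x => w x.1 x.2 r ∧ crit m n r θ x.1 x.2 (sel q) q.1 q.2)).card : ℝ) ≤
      3 * ((mv m n r q.1 q.2).card : ℝ) := by exact_mod_cast this
  refine le_trans (le_of_eq ?_) this2
  rw [← Finset.sum_boole]
  apply Finset.sum_congr rfl
  intro i _
  split_ifs <;> rfl

lemma per_block {m n : ℕ} (Mo : HIModel m n) {θ x : ℝ} (hθ : θ ≤ 1/16) {u t K : ℕ}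
    (hu : 2 ≤ u) (hK : 0 < K) (hK2 : (2 * K + 1 : ℝ) ≤ 5 * (x * (4 * u)))
    (ht : 1 ≤ t) (ht2 : t + 16 * u ≤ n) :
    pprob Mo.C0 (fun A => qt θ (4 * u) t K A.1) ≤ 20 * x *
      (∑ r ∈ Finset.Icc 1 (n + 1), Zc Mo θ win0 (fun q => q.1.1) (4 * u) t r +
       ∑ r ∈ Finset.Icc 1 (n + 1), Zc Mo θ win1 (fun q => q.2.1) (4 * u) t r) := by
  have u0 : (0:ℝ) < u := by exact_mod_cast (by omega : 0 < u)
  have s0 : ∑ r ∈ Finset.Ico (t + u) (t + 2 * u), Zc Mo θ win0 (fun q => q.1.1) (4 * u) t r ≤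
      ∑ r ∈ Finset.Icc 1 (n + 1), Zc Mo θ win0 (fun q => q.1.1) (4 * u) t r := by
    apply Finset.sum_le_sum_of_subset_of_nonneg
    · intro r; simp only [Finset.mem_Ico, Finset.mem_Icc]; omega
    · intros; exact Zc_nonneg _ _ _ _ _ _ _
  have s1 : ∑ r ∈ Finset.Ico (t + u) (t + 2 * u), Zc Mo θ win1 (fun q => q.2.1) (4 * u) t (r + 8 * u) ≤
      ∑ r ∈ Finset.Icc 1 (n + 1), Zc Mo θ win1 (fun q => q.2.1) (4 * u) t r := by
    rw [Finset.sum_Ico_add' (fun r => Zc Mo θ win1 (fun q => q.2.1) (4 * u) t r)]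
    apply Finset.sum_le_sum_of_subset_of_nonneg
    · intro r; simp only [Finset.mem_Ico, Finset.mem_Icc]; omega
    · intros; exact Zc_nonneg _ _ _ _ _ _ _
  have s2 : ∑ r ∈ Finset.Ico (t + u) (t + 2 * u), pprob Mo.C0 (fun A => qt θ (4 * u) t K A.1) ≤
      ∑ r ∈ Finset.Ico (t + u) (t + 2 * u), (2 * K + 1 : ℝ) *
        (Zc Mo θ win0 (fun q => q.1.1) (4 * u) t r + Zc Mo θ win1 (fun q => q.2.1) (4 * u) t (r + 8 * u)) := by
    apply Finset.sum_le_sum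
    intro r hr
    obtain ⟨r1, r2⟩ := Finset.mem_Ico.1 hr
    have w0 : win0 (4 * u) t r := by unfold win0; omega
    have w1 : win1 (4 * u) t (r + 8 * u) := by unfold win1; omega
    have := model_step Mo hθ (h := 4 * u) (t := t) (by omega) hK (by omega) (by omega) w0 w1
    unfold Zc
    simp only [w0, w1, true_and]
    exact this
  rw [← Finset.mul_sum, Finset.sum_add_distrib] at s2
  simp only [Finset.sum_const, Nat.card_Ico, nsmul_eq_mul] at s2
  rw [show t + 2 * u - (t + u) = u by omega] at s2
  set a := ∑ r ∈ Finset.Icc 1 (n + 1), Zc Mo θ win0 (fun q => q.1.1) (4 * u) t r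
  set b := ∑ r ∈ Finset.Icc 1 (n + 1), Zc Mo θ win1 (fun q => q.2.1) (4 * u) t r
  have ha : 0 ≤ a := Finset.sum_nonneg fun _ _ => Zc_nonneg _ _ _ _ _ _ _
  have hb : 0 ≤ b := Finset.sum_nonneg fun _ _ => Zc_nonneg _ _ _ _ _ _ _
  have s3 : (u : ℝ) * pprob Mo.C0 (fun A => qt θ (4 * u) t K A.1) ≤ 5 * (x * (4 * u)) * (a + b) := by
    refine s2.trans ?_
    refine (mul_le_mul_of_nonneg_left (add_le_add s0 s1) (by positivity)).trans ?_
    exact mul_le_mul_of_nonneg_right hK2 (by positivity)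
  have s4 : (u : ℝ) * pprob Mo.C0 (fun A => qt θ (4 * u) t K A.1) ≤ u * (20 * x * (a + b)) := by
    linarith
  exact le_of_mul_le_mul_left s4 u0

lemma main_ineq {m n : ℕ} (Mo : HIModel m n) {ε : ℝ} (hε : 0 < ε) (hε2 : ε ≤ 1/1000)
    (hn : (m : ℝ) - n = ε * m) (Q : ℕ) (hQ : 1 ≤ Q)
    (hlow : ∀ i, 3 * Q ≤ i → 1 ≤ (60 * ε / Real.sqrt Q) * (32 : ℝ) ^ i)
    (hhigh : 400 * 32 ^ (4 * Q) ≤ m) :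
    (Q : ℝ) * m / 2 ≤ 120 * (60 * ε / Real.sqrt Q) * ∑ r ∈ Finset.Icc 1 (n + 1), expPairCost Mo r := by
  set x := 60 * ε / Real.sqrt Q with hx
  have Q0 : (0:ℝ) < Q := by exact_mod_cast hQ
  have x0 : 0 < x := by positivity
  have hx2 : x ^ 2 = 3600 * ε ^ 2 / Q := by
    rw [hx, div_pow, Real.sq_sqrt Q0.le]; ring
  set H := (Finset.Ico (3 * Q) (4 * Q)).image (fun i => 32 ^ i) with hH
  have Hinj : Function.Injective (fun i : ℕ => 32 ^ i) := Nat.pow_right_injective (by norm_num)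
  have Hcard : H.card = Q := by
    rw [hH, Finset.card_image_of_injective _ Hinj, Nat.card_Ico]; omega
  have Hmem : ∀ h ∈ H, ∃ i, 3 * Q ≤ i ∧ i < 4 * Q ∧ h = 32 ^ i := by
    intro h hh
    obtain ⟨i, hi, e⟩ := Finset.mem_image.1 hh
    obtain ⟨i1, i2⟩ := Finset.mem_Ico.1 hi
    exact ⟨i, i1, i2, e.symm⟩
  have Hu : ∀ h ∈ H, ∃ u, h = 4 * u ∧ 2 ≤ u := by
    intro h hh
    obtain ⟨i, i1, i2, e⟩ := Hmem h hh
    obtain ⟨k, rfl⟩ : ∃ k, i = k + 1 := ⟨i - 1, by omega⟩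
    have := Nat.one_le_pow k 32 (by norm_num)
    exact ⟨8 * 32 ^ k, by rw [e, pow_succ]; ring, by omega⟩
  have h8 : ∀ h ∈ H, 8 ≤ h := by
    intro h hh; obtain ⟨u, e, e2⟩ := Hu h hh; omega
  have hs : ∀ h ∈ H, ∀ h' ∈ H, h < h' → 32 * h ≤ h' := by
    intro h hh h' hh' l
    obtain ⟨i, i1, i2, e⟩ := Hmem h hh
    obtain ⟨i', i1', i2', e'⟩ := Hmem h' hh'
    subst e e'
    have : i < i' := (Nat.pow_lt_pow_iff_right (by norm_num)).1 l
    rw [← pow_succ']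
    exact Nat.pow_le_pow_right (by norm_num) this
  have h2p : ∀ h ∈ H, ∃ i < 20 * Q, h = 2 ^ i := by
    intro h hh
    obtain ⟨i, i1, i2, e⟩ := Hmem h hh
    refine ⟨5 * i, by omega, ?_⟩
    rw [e, pow_mul]; norm_num
  have hm400 : ∀ h ∈ H, 400 * h ≤ m := by
    intro h hh
    obtain ⟨i, i1, i2, e⟩ := Hmem h hh
    have : 32 ^ i ≤ 32 ^ (4 * Q) := Nat.pow_le_pow_right (by norm_num) i2.le
    omega
  have hlow' : ∀ h ∈ H, 1 ≤ x * h := by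
    intro h hh
    obtain ⟨i, i1, i2, e⟩ := Hmem h hh
    rw [e]; push_cast; exact hlow i i1
  set K : ℕ → ℕ := fun h => ⌈x * h⌉₊ with hKdef
  have hK1 : ∀ h, x * h ≤ K h := fun h => Nat.le_ceil _
  have hK0 : ∀ h ∈ H, 0 < K h := by
    intro h hh
    have := (hlow' h hh).trans (hK1 h)
    exact_mod_cast this
  have hK2 : ∀ h ∈ H, (2 * K h + 1 : ℝ) ≤ 5 * (x * h) := by
    intro h hh
    have h1 := hlow' h hh
    have h2 := Nat.ceil_lt_add_one (a := x * h) (by linarith)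
    have h3 : (K h : ℝ) < x * h + 1 := h2
    linarith
  have hθ : 10 * ε ≤ 1/16 := by linarith
  -- lower bound
  have low : ∀ A : Config m n, (Q : ℝ) * m / 2 ≤
      ∑ h ∈ H, ∑ t ∈ Finset.Icc 1 (n - 4 * h), if qt (10 * ε) h t (K h) A.1 then (1:ℝ) else 0 := by
    intro A
    simp only [Finset.sum_boole]
    have e1 : ∀ h ∈ H, (m : ℝ) ≤ (((Finset.Icc 1 (n - 4 * h)).filter (fun t => qt (10 * ε) h t (K h) A.1)).card : ℝ)
        + 3 * (ε * m) + m / 10 + Dv (10 * ε) A.1 h / x ^ 2 + m / 100 := by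
      intro h hh
      have a1 := qs_ge (θ := 10 * ε) (by positivity) x0 A h (K h) (h8 h hh) (hK1 h)
      have a2 : (((Finset.range m).filter (qs (10 * ε) A h (K h))).card : ℝ) ≤
        (((Finset.Icc 1 (n - 4 * h)).filter (fun t => qt (10 * ε) h t (K h) A.1)).card : ℝ) := by
        exact_mod_cast qs_le (10 * ε) A h (K h) (h8 h hh)
      have a3 : (400 * h : ℝ) ≤ m := by exact_mod_cast hm400 h hh
      rw [hn] at a1
      have a4 : ε * m / (10 * ε) = m / 10 := by field_simp
      rw [a4] at a1
      linarith
    have e2 := Finset.sum_le_sum e1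
    simp only [Finset.sum_add_distrib, ← Finset.sum_div, Finset.sum_const, Hcard, nsmul_eq_mul] at e2
    have e3 := Dv_sum (θ := 10 * ε) (by positivity) A.1 (20 * Q) H h2p
    have e4 : (∑ h ∈ H, Dv (10 * ε) A.1 h) / x ^ 2 ≤ (2/9) * (Q * m) := by
      rw [div_le_iff₀ (by positivity), hx2]
      refine e3.trans (le_of_eq ?_)
      field_simp; ring
    have e5 : (Q : ℝ) * (3 * (ε * m)) ≤ 3/1000 * (Q * m) := by
      have : (0:ℝ) ≤ Q * m := by positivity
      nlinarith
    have e6 : (0:ℝ) ≤ Q * m := by positivity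
    linarith
  have low2 : (Q : ℝ) * m / 2 ≤
      ∑ h ∈ H, ∑ t ∈ Finset.Icc 1 (n - 4 * h), pprob Mo.C0 (fun A => qt (10 * ε) h t (K h) A.1) := by
    have := pexp_mono Mo.C0 low
    rw [pexp_const, pexp_sum] at this
    simp only [pexp_sum] at this
    exact this
  have up : ∑ h ∈ H, ∑ t ∈ Finset.Icc 1 (n - 4 * h), pprob Mo.C0 (fun A => qt (10 * ε) h t (K h) A.1) ≤
      ∑ h ∈ H, ∑ t ∈ Finset.Icc 1 (n - 4 * h), 20 * x *
      (∑ r ∈ Finset.Icc 1 (n + 1), Zc Mo (10 * ε) win0 (fun q => q.1.1) h t r +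
       ∑ r ∈ Finset.Icc 1 (n + 1), Zc Mo (10 * ε) win1 (fun q => q.2.1) h t r) := by
    apply Finset.sum_le_sum; intro h hh
    apply Finset.sum_le_sum; intro t ht
    obtain ⟨t1, t2⟩ := Finset.mem_Icc.1 ht
    have k0 := hK0 h hh
    have k2 := hK2 h hh
    obtain ⟨u, rfl, u2⟩ := Hu h hh
    apply per_block Mo hθ u2 k0 _ t1 (by omega)
    push_cast at k2; exact k2
  simp only [← Finset.mul_sum, Finset.sum_add_distrib] at up
  have c0 := charge Mo hθ H h8 hs win0 (Or.inl rfl) (fun q => q.1.1)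
  have c1 := charge Mo hθ H h8 hs win1 (Or.inr rfl) (fun q => q.2.1)
  have := mul_le_mul_of_nonneg_left (add_le_add c0 c1) (by positivity : 0 ≤ 20 * x)
  linarith

theorem statement18 :
    ∃ c : ℝ, 10 ≤ c ∧ ∃ κ : ℝ, 0 < κ ∧ ∃ M : ℕ, ∀ m : ℕ, M ≤ m →
      ∀ n : ℕ, n ≤ m →
      ((m : ℝ) ^ (-(1 : ℝ) / 3) ≤ 1 - (n : ℝ) / m) → (1 - (n : ℝ) / m ≤ 1 / c) →
      ∀ Mo : HIModel m n,
      κ * (1 - (n : ℝ) / m)⁻¹ * Real.logb 2 n ^ ((3 : ℝ) / 2) ≤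
        (1 / ((Finset.Icc 1 (n + 1)).card : ℝ)) *
          ∑ r ∈ Finset.Icc 1 (n + 1), expPairCost Mo r := by
  refine ⟨1000, by norm_num, 1/10^7, by norm_num, 32^12, ?_⟩
  intro m hm n hnm h1 h2 Mo
  have m0n : 0 < m := lt_of_lt_of_le (by norm_num) hm
  have m0 : (0:ℝ) < m := by exact_mod_cast m0n
  set ε : ℝ := 1 - (n : ℝ) / m with hεdef
  have hε : 0 < ε := lt_of_lt_of_le (Real.rpow_pos_of_pos m0 _) h1
  have hn : (m : ℝ) - n = ε * m := by
    rw [hεdef]; field_simp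
  obtain ⟨N, hN⟩ : ∃ N, N = Nat.log 32 m := ⟨_, rfl⟩
  have hN1 : 32 ^ N ≤ m := by rw [hN]; exact Nat.pow_log_le_self 32 m0n.ne'
  have hN2 : m < 32 ^ (N + 1) := by rw [hN]; exact Nat.lt_pow_succ_log_self (by norm_num) m
  have hN12 : 12 ≤ N := by
    by_contra hc
    have : 32 ^ (N + 1) ≤ 32 ^ 12 := Nat.pow_le_pow_right (by norm_num) (by omega)
    omega
  obtain ⟨Q, hQ⟩ : ∃ Q, Q = N / 6 := ⟨_, rfl⟩
  have Q2 : 2 ≤ Q := by omega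
  have hQN : 6 * Q ≤ N := by omega
  have hQN2 : N + 1 ≤ 6 * Q + 6 := by omega
  have hm6 : m < 32 ^ (6 * Q + 6) := lt_of_lt_of_le hN2 (Nat.pow_le_pow_right (by norm_num) hQN2)
  have hhigh : 400 * 32 ^ (4 * Q) ≤ m := by
    have a : 32 ^ (6 * Q) ≤ 32 ^ N := Nat.pow_le_pow_right (by norm_num) hQN
    have b : 32 ^ 4 ≤ 32 ^ (2 * Q) := Nat.pow_le_pow_right (by norm_num) (by omega)
    have e : 32 ^ (6 * Q) = 32 ^ (2 * Q) * 32 ^ (4 * Q) := by rw [← pow_add]; congr 1; ring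
    have d : 400 * 32 ^ (4 * Q) ≤ 32 ^ (2 * Q) * 32 ^ (4 * Q) :=
      Nat.mul_le_mul_right _ (le_trans (by norm_num) b)
    omega
  have Qr : (2:ℝ) ≤ Q := by exact_mod_cast Q2
  have Q0 : (0:ℝ) < Q := by linarith
  have sq0 : 0 < Real.sqrt Q := Real.sqrt_pos.2 Q0
  have sqQ : Real.sqrt Q ≤ Q := by
    rw [Real.sqrt_le_left Q0.le]; nlinarith
  have hεlow : 1 ≤ ε * 32 ^ (2 * Q + 2) := by
    have hmr : (m:ℝ) ≤ ((32:ℝ) ^ (2 * Q + 2)) ^ 3 := by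
      rw [← pow_mul]
      have : (m:ℝ) ≤ 32 ^ (6 * Q + 6) := by exact_mod_cast hm6.le
      refine this.trans (le_of_eq ?_); congr 1; ring
    have c1 : (m:ℝ) ^ ((1:ℝ)/3) ≤ 32 ^ (2 * Q + 2) := by
      have := Real.rpow_le_rpow m0.le hmr (by norm_num : (0:ℝ) ≤ 1/3)
      refine this.trans (le_of_eq ?_)
      rw [← Real.rpow_natCast, ← Real.rpow_mul (by positivity)]
      norm_num
    have c2 : (m:ℝ) ^ (-(1:ℝ)/3) * (m:ℝ) ^ ((1:ℝ)/3) = 1 := by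
      rw [← Real.rpow_add m0]; norm_num
    rw [← c2]
    exact mul_le_mul h1 c1 (Real.rpow_nonneg m0.le _) hε.le
  have hlow : ∀ i, 3 * Q ≤ i → 1 ≤ (60 * ε / Real.sqrt Q) * (32 : ℝ) ^ i := by
    intro i hi
    have p1 : (32:ℝ) ^ (3 * Q) ≤ 32 ^ i := pow_le_pow_right₀ (by norm_num) hi
    have p2 : 1024 * Q ≤ 60 * 32 ^ Q := by
      have a : Q < 2 ^ Q := Nat.lt_two_pow_self
      have b : 16 ^ 2 ≤ 16 ^ Q := Nat.pow_le_pow_right (by norm_num) Q2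
      have e : 32 ^ Q = 16 ^ Q * 2 ^ Q := by rw [← mul_pow]; norm_num
      rw [e]; nlinarith
    have p2r : (1024:ℝ) * Q ≤ 60 * 32 ^ Q := by exact_mod_cast p2
    rw [div_mul_eq_mul_div, le_div_iff₀ sq0, one_mul]
    have p3 : 60 * ε * 32 ^ (3 * Q) ≤ 60 * ε * 32 ^ i :=
      mul_le_mul_of_nonneg_left p1 (by positivity)
    refine le_trans ?_ p3
    have e1 : (32:ℝ) ^ (3 * Q) = 32 ^ (2 * Q) * 32 ^ Q := by rw [← pow_add]; congr 1; ring
    have e2 : ε * (32:ℝ) ^ (2 * Q + 2) = 1024 * (ε * 32 ^ (2 * Q)) := by rw [pow_add]; ring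
    rw [e2] at hεlow
    have p4 : 1024 * (Q:ℝ) * (ε * 32 ^ (2 * Q)) ≤ 60 * 32 ^ Q * (ε * 32 ^ (2 * Q)) :=
      mul_le_mul_of_nonneg_right p2r (by positivity)
    rw [e1]
    nlinarith
  have key := main_ineq Mo hε h2 hn Q (by omega) hlow hhigh
  have hnlt : (n:ℝ) < m := by nlinarith [mul_pos hε m0]
  have hnlt' : n < m := by exact_mod_cast hnlt
  have hn1 : (1:ℝ) ≤ n := by
    have : (1:ℝ) < m + 0 := by
      have : 32 ^ 12 ≤ m := hm
      have : (32 ^ 12 : ℝ) ≤ m := by exact_mod_cast this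
      linarith [this, (by norm_num : (1:ℝ) < 32 ^ 12)]
    have h3 : (2:ℝ) ≤ m := by
      have : (2:ℕ) ≤ m := le_trans (by norm_num) hm
      exact_mod_cast this
    nlinarith
  have hl0 : 0 ≤ Real.logb 2 n := Real.logb_nonneg (by norm_num) hn1
  have hl1 : Real.logb 2 n ≤ 60 * Q := by
    have a : (n:ℝ) ≤ 2 ^ (60 * Q) := by
      have : 32 ^ (6 * Q + 6) ≤ 32 ^ (12 * Q) := Nat.pow_le_pow_right (by norm_num) (by omega)
      have e : 32 ^ (12 * Q) = 2 ^ (60 * Q) := by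
        rw [show 60 * Q = 5 * (12 * Q) by ring, pow_mul 2]; norm_num
      have : n ≤ 2 ^ (60 * Q) := by omega
      exact_mod_cast this
    have b := Real.logb_le_logb_of_le (b := 2) (by norm_num) (by linarith) a
    rw [← Real.rpow_natCast, Real.logb_rpow (by norm_num) (by norm_num)] at b
    push_cast at b
    exact b
  have hl2 : Real.logb 2 n ^ ((3 : ℝ) / 2) ≤ 480 * (Q * Real.sqrt Q) := by
    have a := Real.rpow_le_rpow hl0 hl1 (by norm_num : (0:ℝ) ≤ 3/2)
    refine a.trans ?_
    have e : (60 * (Q:ℝ)) ^ ((3:ℝ)/2) = 60 * Q * (Real.sqrt 60 * Real.sqrt Q) := by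
      rw [show (3:ℝ)/2 = 1 + 1/2 by norm_num, Real.rpow_add (by positivity), Real.rpow_one,
        ← Real.sqrt_eq_rpow, Real.sqrt_mul (by norm_num)]
    have s : Real.sqrt 60 ≤ 8 := by
      rw [Real.sqrt_le_left (by norm_num)]; norm_num
    rw [e]
    have : 0 ≤ (Q:ℝ) * Real.sqrt Q := by positivity
    nlinarith
  obtain ⟨S, hS⟩ : ∃ S, S = ∑ r ∈ Finset.Icc 1 (n + 1), expPairCost Mo r := ⟨_, rfl⟩
  rw [← hS] at key ⊢
  have key2 : (Q:ℝ) * Real.sqrt Q * m ≤ 14400 * ε * S := by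
    have := mul_le_mul_of_nonneg_right key sq0.le
    have e : 120 * (60 * ε / Real.sqrt Q) * S * Real.sqrt Q = 7200 * ε * S := by
      field_simp; ring
    rw [e] at this
    linarith
  have hcard : ((Finset.Icc 1 (n + 1)).card : ℝ) = n + 1 := by simp
  have hnm1 : (n:ℝ) + 1 ≤ m := by exact_mod_cast hnlt'
  rw [hcard, one_div_mul_eq_div ((n:ℝ) + 1) S, le_div_iff₀ (by positivity)]
  have f1 : 1 / 10 ^ 7 * ε⁻¹ * Real.logb 2 n ^ ((3 : ℝ) / 2) * ((n:ℝ) + 1) ≤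
      1 / 10 ^ 7 * ε⁻¹ * (480 * (Q * Real.sqrt Q)) * m := by
    apply mul_le_mul _ hnm1 (by positivity) (by positivity)
    exact mul_le_mul_of_nonneg_left hl2 (by positivity)
  refine f1.trans ?_
  have f2 : 1 / 10 ^ 7 * ε⁻¹ * (480 * (Q * Real.sqrt Q)) * m =
      (480 / 10 ^ 7 * (Q * Real.sqrt Q * m)) / ε := by
    field_simp
  rw [f2, div_le_iff₀ hε]
  have : 0 ≤ (Q:ℝ) * Real.sqrt Q * m := by positivity
  nlinarith
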